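/- If A is a wide subcategory of rep Q (or more generally of an Artinian, Krull–Schmidt, hereditary abelian category), then Gen A is a torsion class; that is, the class of quotients of objects of A is closed under extensions and quotients. -/

import Mathlib

open CategoryTheory CategoryTheory.Limits ZeroObject

attribute [local instance] CategoryTheory.Abelian.hasFiniteBiproducts

noncomputable section

namespace NCPaper

/-- A finite quiver without oriented cycles. -/
structure FinQuiver : Type 1 where
  V : Type
  [quiver : Quiver.{0} V]
  [fintypeV : Fintype V]
  [fintypeArr : ∀ a b : V, Fintype (a ⟶ b)]
  acyclic : ∀ (v : V) (p : Quiver.Path v v), p = Quiver.Path.nil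

attribute [instance] FinQuiver.quiver FinQuiver.fintypeV FinQuiver.fintypeArr

variable (k : Type) [Field k] (Q : FinQuiver)

/-- The ambient abelian category of all `k`-linear representations of `Q`;
finite-dimensional representations are singled out by the predicate `FinDim`. -/
abbrev RepC : Type 1 := Paths Q.V ⥤ ModuleCat.{0} k

variable {k Q}

/-- `M` is a finite-dimensional representation, i.e. an object of `rep Q`. -/
def FinDim (M : RepC k Q) : Prop :=
  ∀ v : Q.V, FiniteDimensional k (M.obj ((Paths.of Q.V).obj v))

section Cat

variable {C : Type*} [Category C] [Abelian C]

/-- `X` is a direct summand of `A`. -/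
def IsSummand (X A : C) : Prop := ∃ (i : X ⟶ A) (r : A ⟶ X), i ≫ r = 𝟙 X

/-- The additive closure of a set of objects: direct summands of finite direct sums. -/
def addSet (S : Set C) : Set C :=
  { X | ∃ (n : ℕ) (f : Fin n → C), (∀ i, f i ∈ S) ∧ IsSummand X (⨁ f) }

/-- `Gen S`: all quotients of objects of the additive closure of `S`. -/
def gen (S : Set C) : Set C := { X | ∃ A ∈ addSet S, ∃ p : A ⟶ X, Epi p }

/-- All morphisms from `A` to `B` vanish. -/
def HomZero (A B : C) : Prop := ∀ f : A ⟶ B, f = 0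

/-- `Ext¹(A, B) = 0`, expressed by the splitting of all short exact sequences
`0 ⟶ B ⟶ E ⟶ A ⟶ 0`. -/
def Ext1Zero (A B : C) : Prop :=
  ∀ (E : C) (i : B ⟶ E) (p : E ⟶ A) (w : i ≫ p = 0),
    (ShortComplex.mk i p w).ShortExact → ∃ r : E ⟶ B, i ≫ r = 𝟙 B

/-- An indecomposable object. -/
def Indec (X : C) : Prop :=
  ¬ IsZero X ∧ ∀ (A B : C), (X ≅ A ⊞ B) → IsZero A ∨ IsZero B

/-- A torsion class: a full subcategory (identified with its set of objects) closed under
direct sums, direct summands, quotients and extensions. -/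
structure IsTorsionClass (T : Set C) : Prop where
  zero_mem : (0 : C) ∈ T
  sum_mem : ∀ X ∈ T, ∀ Y ∈ T, (X ⊞ Y : C) ∈ T
  summand_mem : ∀ X ∈ T, ∀ Y : C, IsSummand Y X → Y ∈ T
  quot_mem : ∀ X ∈ T, ∀ (Y : C) (p : X ⟶ Y), Epi p → Y ∈ T
  ext_mem : ∀ S : ShortComplex C, S.ShortExact → S.X₁ ∈ T → S.X₃ ∈ T → S.X₂ ∈ T

/-- A wide subcategory: a full subcategory (closed under direct sums and summands)
which is exact abelian (closed under kernels and cokernels) and closed under extensions. -/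
structure IsWide (A : Set C) : Prop where
  zero_mem : (0 : C) ∈ A
  sum_mem : ∀ X ∈ A, ∀ Y ∈ A, (X ⊞ Y : C) ∈ A
  summand_mem : ∀ X ∈ A, ∀ Y : C, IsSummand Y X → Y ∈ A
  ker_mem : ∀ X ∈ A, ∀ Y ∈ A, ∀ f : X ⟶ Y, (kernel f : C) ∈ A
  coker_mem : ∀ X ∈ A, ∀ Y ∈ A, ∀ f : X ⟶ Y, (cokernel f : C) ∈ A
  ext_mem : ∀ S : ShortComplex C, S.ShortExact → S.X₁ ∈ A → S.X₃ ∈ A → S.X₂ ∈ A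

/-- `P` is split projective in the subcategory `T`: every epimorphism onto `P`
from an object of `T` splits. -/
def SplitProjIn (T : Set C) (P : C) : Prop :=
  P ∈ T ∧ ∀ X ∈ T, ∀ p : X ⟶ P, Epi p → ∃ s : P ⟶ X, s ≫ p = 𝟙 P

/-- `P` is Ext-projective in the subcategory `T`. -/
def ExtProjIn (T : Set C) (P : C) : Prop := P ∈ T ∧ ∀ X ∈ T, Ext1Zero P X

/-- The subcategory `a(T)` associated to a torsion class `T`. -/
def aSet (T : Set C) : Set C :=
  { B | B ∈ T ∧ ∀ Y ∈ T, ∀ g : Y ⟶ B, (kernel g : C) ∈ T }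

/-- A subcategory is finitely generated if it is generated by a single object of it. -/
def IsFinGen (T : Set C) : Prop := ∃ U ∈ T, T ⊆ gen {U}

/-- `U` is a generator of the subcategory `T`. -/
def IsGenerator (T : Set C) (U : C) : Prop := U ∈ T ∧ T ⊆ gen {U}

/-- `X` is a subquotient of `M`. -/
def IsSubquotient (X M : C) : Prop := ∃ (N : C) (i : N ⟶ M) (p : N ⟶ X), Mono i ∧ Epi p

/-- The support of `M` is contained in the support of `C0`: every simple subquotient
(composition factor) of `M` is a composition factor of `C0`. -/
def SuppLE (M C0 : C) : Prop := ∀ S : C, Simple S → IsSubquotient S M → IsSubquotient S C0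

/-- A partial tilting object of a hereditary category. -/
def IsPartialTilting (T : C) : Prop := Ext1Zero T T

/-- `T` is a tilting object of the full subcategory `A`: it is self-orthogonal and every
(split) projective object of `A` admits a coresolution `0 ⟶ P ⟶ T' ⟶ T'' ⟶ 0` with
`T', T'' ∈ add T`. For `A` the subcategory of representations supported on `supp T`,
this says exactly that `T` is a tilting `kQ/ann T`-module. -/
def TiltingIn (A : Set C) (T : C) : Prop :=
  T ∈ A ∧ Ext1Zero T T ∧
    ∀ P : C, SplitProjIn A P →
      ∃ (T' T'' : C) (_ : T' ∈ addSet {T}) (_ : T'' ∈ addSet {T})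
        (i : P ⟶ T') (p : T' ⟶ T'') (w : i ≫ p = 0),
        (ShortComplex.mk i p w).ShortExact


/-- `U` is the direct sum of one representative of each isomorphism class of
indecomposable Ext-projective objects of `T`. -/
def IsExtProjSum (T : Set C) (U : C) : Prop :=
  ∃ (n : ℕ) (f : Fin n → C),
    (∀ i, Indec (f i) ∧ ExtProjIn T (f i)) ∧
    (∀ i j, Nonempty (f i ≅ f j) → i = j) ∧
    (∀ P : C, Indec P → ExtProjIn T P → ∃ i, Nonempty (P ≅ f i)) ∧
    Nonempty (U ≅ ⨁ f)

/-- A basic object: a direct sum of pairwise non-isomorphic indecomposables. -/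
def IsBasic (U : C) : Prop :=
  ∃ (n : ℕ) (f : Fin n → C), (∀ i, Indec (f i)) ∧
    (∀ i j, Nonempty (f i ≅ f j) → i = j) ∧ Nonempty (U ≅ ⨁ f)

end Cat

/-- A support tilting object of `rep Q`: partial tilting, and tilting as a
`kQ/ann T`-module, i.e. tilting in the subcategory of all finite-dimensional
representations supported on the support of `T`. -/
def IsSupportTilting {k : Type} [Field k] {Q : FinQuiver} (T : RepC k Q) : Prop :=
  IsPartialTilting T ∧ TiltingIn { M : RepC k Q | FinDim M ∧ SuppLE M T } T

section Comb

/-- The dimension vector of a representation. -/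
def dimVec {k : Type} [Field k] {Q : FinQuiver} (M : RepC k Q) : Q.V → ℤ :=
  fun v => (Module.finrank k (M.obj ((Paths.of Q.V).obj v)) : ℤ)

/-- The Euler form of the quiver `Q`. -/
def euler (Q : FinQuiver) {R : Type} [CommRing R] (α β : Q.V → R) : R :=
  (∑ v : Q.V, α v * β v) - ∑ a : (Σ x : Q.V, Σ y : Q.V, x ⟶ y), α a.1 * β a.2.1

/-- The symmetrized Euler form of the quiver `Q`. -/
def symEuler (Q : FinQuiver) {R : Type} [CommRing R] (α β : Q.V → R) : R :=
  euler Q α β + euler Q β α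

/-- The reflection in the vector `v`: `s_v(w) = w - (v, w)·v`. -/
def reflV (Q : FinQuiver) (v : Q.V → ℤ) : (Q.V → ℤ) → (Q.V → ℤ) :=
  fun w => w - symEuler Q v w • v

/-- The composition (product, written from left to right) of a finite sequence of
linear transformations. -/
def comps (Q : FinQuiver) {m : ℕ} (g : Fin m → ((Q.V → ℤ) → (Q.V → ℤ))) :
    (Q.V → ℤ) → (Q.V → ℤ) :=
  (List.ofFn g).foldr (· ∘ ·) id

open scoped Classical in
/-- The simple root at a vertex. -/
def simRoot (Q : FinQuiver) (v : Q.V) : Q.V → ℤ := fun w => if w = v then 1 else 0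

/-- The simple reflection at a vertex. -/
def sref (Q : FinQuiver) (v : Q.V) : (Q.V → ℤ) → (Q.V → ℤ) := reflV Q (simRoot Q v)

/-- An enumeration of the vertices is compatible with the arrows of `Q` if sources
of arrows come before targets. -/
def OrdCompatible (Q : FinQuiver) (ord : Fin (Fintype.card Q.V) ≃ Q.V) : Prop :=
  ∀ (x y : Q.V), (x ⟶ y) → ord.symm x < ord.symm y

/-- The Coxeter element `cox(Q)`: the product of the simple reflections from left to
right in an order compatible with the arrows of `Q`. -/
def coxeter (Q : FinQuiver) (ord : Fin (Fintype.card Q.V) ≃ Q.V) :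
    (Q.V → ℤ) → (Q.V → ℤ) :=
  comps Q fun i => sref Q (ord i)

/-- The product of the simple reflections indexed by a word (a list of vertices). -/
def wordProd (Q : FinQuiver) (l : List Q.V) : (Q.V → ℤ) → (Q.V → ℤ) :=
  (l.map (sref Q)).foldr (· ∘ ·) id

/-- Membership in the Coxeter group `W` (realized faithfully on the root lattice). -/
def InW (Q : FinQuiver) (w : (Q.V → ℤ) → (Q.V → ℤ)) : Prop :=
  ∃ l : List Q.V, w = wordProd Q l

/-- The reflections of `W`: the conjugates of the simple reflections. -/
def IsRefl (Q : FinQuiver) (t : (Q.V → ℤ) → (Q.V → ℤ)) : Prop :=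
  ∃ (l : List Q.V) (i : Q.V), t = wordProd Q l ∘ sref Q i ∘ wordProd Q l.reverse

/-- The absolute length: the least length of an expression as a product of reflections. -/
def ellT (Q : FinQuiver) (w : (Q.V → ℤ) → (Q.V → ℤ)) : ℕ :=
  sInf { m | ∃ f : Fin m → ((Q.V → ℤ) → (Q.V → ℤ)), (∀ i, IsRefl Q (f i)) ∧ w = comps Q f }

/-- The absolute order on `W`. -/
def absLe (Q : FinQuiver) : ((Q.V → ℤ) → (Q.V → ℤ)) → ((Q.V → ℤ) → (Q.V → ℤ)) → Prop :=
  Relation.ReflTransGen fun u v => ∃ t, IsRefl Q t ∧ v = u ∘ t ∧ ellT Q v = ellT Q u + 1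

/-- The noncrossing partitions `NC_Q`: the interval `[e, cox(Q)]` in absolute order. -/
def NCSet (Q : FinQuiver) (ord : Fin (Fintype.card Q.V) ≃ Q.V) :
    Set ((Q.V → ℤ) → (Q.V → ℤ)) :=
  { w | InW Q w ∧ absLe Q w (coxeter Q ord) }

/-- `Q` is of finite (Dynkin) type: the symmetrized Euler form is positive definite. -/
def FiniteType (Q : FinQuiver) : Prop :=
  ∀ α : Q.V → ℚ, α ≠ 0 → 0 < symEuler Q α α

/-- `Q` is of affine (extended Dynkin) type: the symmetrized Euler form is positive
semidefinite with nontrivial radical. -/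
def AffineType (Q : FinQuiver) : Prop :=
  (∀ α : Q.V → ℚ, 0 ≤ symEuler Q α α) ∧ ∃ α : Q.V → ℚ, α ≠ 0 ∧ symEuler Q α α = 0

end Comb

section Helpers

lemma repC_exact_of_eval {k : Type} [Field k] {Q : FinQuiver} (S : ShortComplex (RepC k Q))
    (h : ∀ v, (S.map ((evaluation (Paths Q.V) (ModuleCat.{0} k)).obj v)).Exact) : S.Exact := by
  rw [ShortComplex.exact_iff_isZero_homology]
  refine Functor.isZero _ fun v => ?_
  have := (ShortComplex.exact_iff_isZero_homology _).1 (h v)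
  exact this.of_iso (S.mapHomologyIso ((evaluation (Paths Q.V) (ModuleCat.{0} k)).obj v)).symm

/-- The extension of `N` by `M` given by a cocycle `c`. -/
def extRep {k : Type} [Field k] {Q : FinQuiver} (M N : RepC k Q)
    (c : ∀ (x y : Q.V) (_ : x ⟶ y),
      N.obj ((Paths.of Q.V).obj x) →ₗ[k] M.obj ((Paths.of Q.V).obj y)) : RepC k Q :=
  Paths.lift
    { obj := fun v => ModuleCat.of k
        (M.obj ((Paths.of Q.V).obj v) × N.obj ((Paths.of Q.V).obj v))
      map := fun {x y} a => ModuleCat.ofHom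
        (LinearMap.prod
          (LinearMap.coprod (M.map ((Paths.of Q.V).map a)).hom (c x y a))
          ((N.map ((Paths.of Q.V).map a)).hom ∘ₗ LinearMap.snd k _ _)) }

lemma extRep_map {k : Type} [Field k] {Q : FinQuiver} (M N : RepC k Q)
    (c : ∀ (x y : Q.V) (_ : x ⟶ y),
      N.obj ((Paths.of Q.V).obj x) →ₗ[k] M.obj ((Paths.of Q.V).obj y)) {x y : Q.V} (a : x ⟶ y) :
    (extRep M N c).map ((Paths.of Q.V).map a) = ModuleCat.ofHom
        (LinearMap.prod
          (LinearMap.coprod (M.map ((Paths.of Q.V).map a)).hom (c x y a))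
          ((N.map ((Paths.of Q.V).map a)).hom ∘ₗ LinearMap.snd k _ _)) :=
  Paths.lift_toPath _ a

def extInl {k : Type} [Field k] {Q : FinQuiver} (M N : RepC k Q)
    (c : ∀ (x y : Q.V) (_ : x ⟶ y),
      N.obj ((Paths.of Q.V).obj x) →ₗ[k] M.obj ((Paths.of Q.V).obj y)) : M ⟶ extRep M N c :=
  Paths.liftNatTrans (fun v => ModuleCat.ofHom (LinearMap.inl k (M.obj v) (N.obj v))) (by
    intro x y a
    refine ModuleCat.hom_ext (LinearMap.ext fun m => ?_)
    refine Prod.ext ?_ ?_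
    · exact (((congrArg ((M.map ((Paths.of Q.V).map a)).hom m + ·) (map_zero (c x y a))).trans (add_zero _))).symm
    · exact (map_zero (N.map ((Paths.of Q.V).map a)).hom).symm)

def extSnd {k : Type} [Field k] {Q : FinQuiver} (M N : RepC k Q)
    (c : ∀ (x y : Q.V) (_ : x ⟶ y),
      N.obj ((Paths.of Q.V).obj x) →ₗ[k] M.obj ((Paths.of Q.V).obj y)) : extRep M N c ⟶ N :=
  Paths.liftNatTrans (fun v => ModuleCat.ofHom (LinearMap.snd k (M.obj v) (N.obj v))) (by
    intro x y a
    refine ModuleCat.hom_ext (LinearMap.ext fun m => ?_)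
    rfl)

lemma ext_w {k : Type} [Field k] {Q : FinQuiver} (M N : RepC k Q)
    (c : ∀ (x y : Q.V) (_ : x ⟶ y),
      N.obj ((Paths.of Q.V).obj x) →ₗ[k] M.obj ((Paths.of Q.V).obj y)) :
    extInl M N c ≫ extSnd M N c = 0 := by
  ext v m
  rfl

lemma ext_shortExact {k : Type} [Field k] {Q : FinQuiver} (M N : RepC k Q)
    (c : ∀ (x y : Q.V) (_ : x ⟶ y),
      N.obj ((Paths.of Q.V).obj x) →ₗ[k] M.obj ((Paths.of Q.V).obj y)) :
    (ShortComplex.mk _ _ (ext_w M N c)).ShortExact where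
  exact := by
    apply repC_exact_of_eval
    intro v
    rw [ShortComplex.moduleCat_exact_iff]
    rintro ⟨m, n⟩ (h : n = 0)
    subst h
    exact ⟨m, rfl⟩
  mono_f := by
    change Mono (extInl M N c)
    rw [NatTrans.mono_iff_mono_app]
    intro v
    rw [ModuleCat.mono_iff_injective]
    exact LinearMap.inl_injective (R := k) (M := M.obj v) (M₂ := N.obj v)
  epi_g := by
    change Epi (extSnd M N c)
    rw [NatTrans.epi_iff_epi_app]
    intro v
    rw [ModuleCat.epi_iff_surjective]
    exact LinearMap.snd_surjective (R := k) (M := M.obj v) (M₂ := N.obj v)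

/-- hereditary: an extension of quotients is a quotient of an extension. -/
lemma exists_ext_epi {k : Type} [Field k] {Q : FinQuiver} (S : ShortComplex (RepC k Q))
    (hS : S.ShortExact) (M N : RepC k Q) (q : M ⟶ S.X₁) [Epi q] (p : N ⟶ S.X₃) [Epi p] :
    ∃ (T : ShortComplex (RepC k Q)) (_ : T.ShortExact) (_ : T.X₁ = M) (_ : T.X₃ = N)
      (f : T.X₂ ⟶ S.X₂), Epi f := by
  have hq : ∀ v, Function.Surjective (q.app v).hom := fun v =>
    (ModuleCat.epi_iff_surjective _).1 inferInstance
  have hp : ∀ v, Function.Surjective (p.app v).hom := fun v =>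
    (ModuleCat.epi_iff_surjective _).1 inferInstance
  have hE := fun v => hS.map_of_exact ((evaluation (Paths Q.V) (ModuleCat.{0} k)).obj v)
  have hg : ∀ v, Function.Surjective (S.g.app v).hom := fun v =>
    (ModuleCat.epi_iff_surjective _).1 (hE v).epi_g
  have hex : ∀ v (e : S.X₂.obj v), (S.g.app v).hom e = 0 → ∃ m : M.obj v,
      (S.f.app v).hom ((q.app v).hom m) = e := by
    intro v e he
    obtain ⟨x, hx⟩ := (ShortComplex.moduleCat_exact_iff _).1 (hE v).exact e he
    obtain ⟨m, rfl⟩ := hq v x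
    exact ⟨m, hx⟩
  choose s hs using fun v => Module.projective_lifting_property (S.g.app v).hom (p.app v).hom (hg v)
  have hs' : ∀ v n, (S.g.app v).hom (s v n) = (p.app v).hom n := fun v n =>
    LinearMap.congr_fun (hs v) n
  have hc : ∀ (x y : Q.V) (a : x ⟶ y), ∃ c : N.obj ((Paths.of Q.V).obj x) →ₗ[k]
      M.obj ((Paths.of Q.V).obj y), ∀ n, (S.f.app ((Paths.of Q.V).obj y)).hom
        ((q.app ((Paths.of Q.V).obj y)).hom (c n)) =
        (S.X₂.map ((Paths.of Q.V).map a)).hom (s ((Paths.of Q.V).obj x) n) -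
          s ((Paths.of Q.V).obj y) ((N.map ((Paths.of Q.V).map a)).hom n) := by
    intro x y a
    let F := (S.f.app ((Paths.of Q.V).obj y)).hom ∘ₗ (q.app ((Paths.of Q.V).obj y)).hom
    let G := (S.X₂.map ((Paths.of Q.V).map a)).hom ∘ₗ s ((Paths.of Q.V).obj x) -
          s ((Paths.of Q.V).obj y) ∘ₗ (N.map ((Paths.of Q.V).map a)).hom
    have hG : ∀ n, G n ∈ LinearMap.range F := by
      intro n
      apply hex
      change (S.g.app ((Paths.of Q.V).obj y)).hom
        ((S.X₂.map ((Paths.of Q.V).map a)).hom (s ((Paths.of Q.V).obj x) n) -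
          s ((Paths.of Q.V).obj y) ((N.map ((Paths.of Q.V).map a)).hom n)) = 0
      rw [map_sub, hs']
      have h1 := NatTrans.naturality_apply S.g ((Paths.of Q.V).map a) (s ((Paths.of Q.V).obj x) n)
      have h2 := NatTrans.naturality_apply p ((Paths.of Q.V).map a) n
      have h3 := hs' ((Paths.of Q.V).obj x) n
      refine sub_eq_zero.2 (h1.trans (Eq.trans ?_ h2.symm))
      exact congrArg (S.X₃.map ((Paths.of Q.V).map a)).hom h3
    obtain ⟨c, hc⟩ := Module.projective_lifting_property F.rangeRestrict
      (G.codRestrict _ hG) F.surjective_rangeRestrict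
    exact ⟨c, fun n => congrArg Subtype.val (LinearMap.congr_fun hc n)⟩
  choose c hc using hc
  let f : extRep M N c ⟶ S.X₂ := Paths.liftNatTrans
    (fun v => ModuleCat.ofHom (LinearMap.coprod
      ((S.f.app ((Paths.of Q.V).obj v)).hom ∘ₗ (q.app ((Paths.of Q.V).obj v)).hom)
      (s ((Paths.of Q.V).obj v)))) (by
    intro x y a
    refine ModuleCat.hom_ext (LinearMap.ext fun mn => ?_)
    obtain ⟨m, n⟩ := mn
    change (S.f.app ((Paths.of Q.V).obj y)).hom ((q.app ((Paths.of Q.V).obj y)).hom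
        ((M.map ((Paths.of Q.V).map a)).hom m + c x y a n)) +
        s ((Paths.of Q.V).obj y) ((N.map ((Paths.of Q.V).map a)).hom n) =
      (S.X₂.map ((Paths.of Q.V).map a)).hom ((S.f.app ((Paths.of Q.V).obj x)).hom
        ((q.app ((Paths.of Q.V).obj x)).hom m) + s ((Paths.of Q.V).obj x) n)
    rw [map_add, map_add, map_add, hc]
    have h1 : (S.f.app ((Paths.of Q.V).obj y)).hom ((q.app ((Paths.of Q.V).obj y)).hom
        ((M.map ((Paths.of Q.V).map a)).hom m)) = 
        (S.X₂.map ((Paths.of Q.V).map a)).hom ((S.f.app ((Paths.of Q.V).obj x)).hom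
        ((q.app ((Paths.of Q.V).obj x)).hom m)) :=
      NatTrans.naturality_apply (q ≫ S.f) ((Paths.of Q.V).map a) m
    rw [h1]
    abel)
  refine ⟨_, ext_shortExact M N c, rfl, rfl, f, ?_⟩
  rw [NatTrans.epi_iff_epi_app]
  intro v
  rw [ModuleCat.epi_iff_surjective]
  intro e
  obtain ⟨n, hn⟩ := hp v ((S.g.app v).hom e)
  obtain ⟨m, hm⟩ := hex v (e - s v n) (by rw [map_sub, hs', hn, sub_self])
  refine ⟨(m, n), ?_⟩
  change (S.f.app v).hom ((q.app v).hom m) + s v n = e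
  rw [hm, sub_add_cancel]

lemma biproduct_mem {C : Type*} [Category C] [Abelian C] {A : Set C} (hA : IsWide A) :
    ∀ (n : ℕ) (f : Fin n → C), (∀ i, f i ∈ A) → (⨁ f) ∈ A := by
  intro n
  induction n with
  | zero =>
    intro f _
    refine hA.summand_mem _ hA.zero_mem _ ⟨0, 0, ?_⟩
    apply biproduct.hom_ext
    intro j
    exact j.elim0
  | succ n ih =>
    intro f hf
    refine hA.summand_mem _ (hA.sum_mem _ (hf 0) _ (ih (fun i => f i.succ) fun i => hf _)) _
      ⟨biprod.lift (biproduct.π f 0) (biproduct.lift fun i => biproduct.π f i.succ),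
       biprod.desc (biproduct.ι f 0) (biproduct.desc fun i => biproduct.ι f i.succ), ?_⟩
    rw [biprod.lift_desc, biproduct.lift_desc, ← biproduct.total, Fin.sum_univ_succ]

lemma mem_gen_iff {C : Type*} [Category C] [Abelian C] {A : Set C} (hA : IsWide A) (X : C) :
    X ∈ gen A ↔ ∃ B ∈ A, ∃ p : B ⟶ X, Epi p := by
  constructor
  · rintro ⟨B, ⟨n, f, hf, hs⟩, p, hp⟩
    exact ⟨B, hA.summand_mem _ (biproduct_mem hA n f hf) _ hs, p, hp⟩
  · rintro ⟨B, hB, p, hp⟩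
    refine ⟨B, ⟨1, fun _ => B, fun _ => hB, biproduct.ι (fun _ : Fin 1 => B) 0,
      biproduct.π (fun _ : Fin 1 => B) 0, ?_⟩, p, hp⟩
    simp

end Helpers

section Statement5

/-- If `A` is a wide subcategory of `rep Q` then `Gen A` is a torsion
class: the class of quotients of objects of `A` is closed under extensions and
quotients (as well as direct sums and summands). -/
theorem statement5 (k : Type) [Field k] [IsAlgClosed k] (Q : FinQuiver)
    (A : Set (RepC k Q)) (hA : IsWide A) (hfd : ∀ X ∈ A, FinDim X) :
    IsTorsionClass (gen A) := by
  have hq : ∀ X ∈ gen A, ∀ (Y : RepC k Q) (p : X ⟶ Y), Epi p → Y ∈ gen A := by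
    rintro X ⟨B, hB, q, hq⟩ Y p hp
    exact ⟨B, hB, q ≫ p, epi_comp _ _⟩
  refine ⟨?_, ?_, ?_, hq, ?_⟩
  · exact (mem_gen_iff hA _).2 ⟨0, hA.zero_mem, 𝟙 _, inferInstance⟩
  · intro X hX Y hY
    obtain ⟨B, hB, p, hp⟩ := (mem_gen_iff hA _).1 hX
    obtain ⟨B', hB', p', hp'⟩ := (mem_gen_iff hA _).1 hY
    exact (mem_gen_iff hA _).2 ⟨B ⊞ B', hA.sum_mem _ hB _ hB', biprod.map p p', inferInstance⟩
  · rintro X hX Y ⟨i, r, h⟩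
    refine hq X hX Y r ?_
    haveI : IsSplitEpi r := ⟨⟨⟨i, h⟩⟩⟩
    infer_instance
  · intro S hS h1 h3
    obtain ⟨B, hB, p, hp⟩ := (mem_gen_iff hA _).1 h1
    obtain ⟨B', hB', p', hp'⟩ := (mem_gen_iff hA _).1 h3
    obtain ⟨T, hT, e1, e3, f, hf⟩ := exists_ext_epi S hS B B' p p'
    exact (mem_gen_iff hA _).2 ⟨T.X₂, hA.ext_mem T hT (e1 ▸ hB) (e3 ▸ hB'), f, hf⟩

end Statement5
end NCPaper
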